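/- Let ρ be an irreducible finite-dimensional complex representation of SL(2,ℤ) with congruence kernel, possessing a nonzero T-fixed vector, and let k ≥ 3 be an integer such that −I acts on ρ by (−1)^k. Then ρ embeds into the SL(2,ℤ)-representation 𝓔_k(ρ) spanned by the component functions v∘E for E a holomorphic Eisenstein series of weight k and type ρ and v a linear functional on V(ρ). -/

import Mathlib

open scoped MatrixGroups Topology Manifold
open Complex UpperHalfPlane Filter

/-- The weight-`k` slash action of `γ ∈ SL(2, ℤ)` on functions on the upper half-plane:
`(f ∣[k] γ)(τ) = (c τ + d)^{-k} f(γ τ)`. -/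
noncomputable def slashfn (k : ℕ) (γ : SL(2, ℤ)) (f : ℍ → ℂ) : ℍ → ℂ :=
  fun τ => (((γ.1 1 0 : ℤ) : ℂ) * (τ : ℂ) + ((γ.1 1 1 : ℤ) : ℂ)) ^ (-(k : ℤ)) * f (γ • τ)

/-- The subgroup `Γ∞^± = ⟨T, -I⟩` of `SL(2, ℤ)`. -/
def GammaInf : Subgroup SL(2, ℤ) := Subgroup.closure {ModularGroup.T, -1}

/-- The component `w ∘ E_{k,ρ,v}` of the vector-valued Eisenstein series of weight `k`,
type `ρ` and `T`-fixed vector `v`: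
`E_{k,ρ,v}(τ) = Σ_{γ ∈ ⟨T,-I⟩\SL(2,ℤ)} (c_γ τ + d_γ)^{-k} ρ(γ)⁻¹ v`,
paired with a linear functional `w ∈ V(ρ)^∨` (the sum is taken over a choice of coset
representatives; for `k ≥ 3` and `v` `T`-fixed of parity `(-1)^k` it is independent of
this choice and absolutely convergent). -/
noncomputable def eisComponent {V : Type*} [AddCommGroup V] [Module ℂ V]
    (ρ : Representation ℂ SL(2, ℤ) V) (k : ℕ) (v : V) (w : Module.Dual ℂ V) : ℍ → ℂ :=
  fun τ => ∑' q : Quotient (QuotientGroup.rightRel GammaInf),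
    (((q.out.1 1 0 : ℤ) : ℂ) * (τ : ℂ) + ((q.out.1 1 1 : ℤ) : ℂ)) ^ (-(k : ℤ)) *
      w (ρ (q.out)⁻¹ v)

theorem mem_GammaInf_of_lower_left_eq_zero {g : SL(2, ℤ)} (h : g.1 1 0 = 0) :
    g ∈ GammaInf := by
  have hT : ModularGroup.T ∈ GammaInf := Subgroup.subset_closure (by simp)
  have hI : (-1 : SL(2, ℤ)) ∈ GammaInf := Subgroup.subset_closure (by simp)
  have hdet : g.1 0 0 * g.1 1 1 = 1 := by
    have := g.det_coe
    rw [Matrix.det_fin_two, h] at this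
    linarith
  rcases Int.mul_eq_one_iff_eq_one_or_neg_one.mp hdet with ⟨ha, hd⟩ | ⟨ha, hd⟩
  · have : g = ModularGroup.T ^ (g.1 0 1) := by
      ext i j
      rw [ModularGroup.coe_T_zpow]
      fin_cases i <;> fin_cases j <;> simp [h, ha, hd]
    rw [this]
    exact zpow_mem hT _
  · have : g = -1 * ModularGroup.T ^ (-g.1 0 1) := by
      ext i j
      rw [Matrix.SpecialLinearGroup.coe_mul, ModularGroup.coe_T_zpow]
      fin_cases i <;> fin_cases j <;> simp [h, ha, hd]
    rw [this]
    exact mul_mem hI (zpow_mem hT _)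

theorem mul_inv_mem_GammaInf_of_lower_row_eq {g h : SL(2, ℤ)} (h0 : g.1 1 0 = h.1 1 0)
    (h1 : g.1 1 1 = h.1 1 1) : h * g⁻¹ ∈ GammaInf := by
  apply mem_GammaInf_of_lower_left_eq_zero
  rw [Matrix.SpecialLinearGroup.coe_mul, Matrix.mul_apply, Fin.sum_univ_two]
  simp [Matrix.SpecialLinearGroup.SL2_inv_expl, h0, h1]
  ring

theorem automorphy_ne_zero (g : SL(2, ℤ)) (τ : ℍ) :
    ((g.1 1 0 : ℤ) : ℂ) * (τ : ℂ) + ((g.1 1 1 : ℤ) : ℂ) ≠ 0 :=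
  UpperHalfPlane.denom_ne_zero (g : GL (Fin 2) ℝ) τ

/-- The automorphy factor of a product of matrices. -/
theorem automorphy_mul (g h : SL(2, ℤ)) (τ : ℍ) :
    (((g * h).1 1 0 : ℤ) : ℂ) * (τ : ℂ) + (((g * h).1 1 1 : ℤ) : ℂ) =
      (((g.1 1 0 : ℤ) : ℂ) * ((h • τ : ℍ) : ℂ) + ((g.1 1 1 : ℤ) : ℂ)) *
        (((h.1 1 0 : ℤ) : ℂ) * (τ : ℂ) + ((h.1 1 1 : ℤ) : ℂ)) := by
  have hne := automorphy_ne_zero h τ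
  rw [UpperHalfPlane.coe_specialLinearGroup_apply]
  simp only [Matrix.SpecialLinearGroup.coe_mul, Matrix.mul_apply, Fin.sum_univ_two,
    algebraMap_int_eq, eq_intCast, ofReal_intCast, Int.cast_add, Int.cast_mul]
  field_simp
  ring

theorem norm_mul_I_add_le (c d : ℤ) {y : ℝ} (hy : 1 ≤ y) :
    ‖(c : ℂ) * Complex.I + d‖ ≤ ‖(c : ℂ) * (y * Complex.I) + d‖ := by
  rw [Complex.norm_def, Complex.norm_def]
  apply Real.sqrt_le_sqrt
  simp only [Complex.normSq_apply]
  simp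
  nlinarith [mul_nonneg (mul_self_nonneg (c : ℝ)) (by nlinarith : 0 ≤ y * y - 1)]

theorem tendsto_mul_I_add_zpow {c : ℤ} (hc : c ≠ 0) (d : ℤ) {k : ℕ} (hk : k ≠ 0) :
    Tendsto (fun n : ℕ => ((c : ℂ) * (((n + 1 : ℝ) : ℂ) * Complex.I) + d) ^ (-(k : ℤ)))
      atTop (𝓝 0) := by
  have hnorm : Tendsto (fun n : ℕ => ‖(c : ℂ) * (((n + 1 : ℝ) : ℂ) * Complex.I) + d‖)
      atTop atTop := by
    refine tendsto_atTop_mono (fun n => ?_) tendsto_natCast_atTop_atTop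
    refine le_trans ?_ (Complex.abs_im_le_norm _)
    have h1 : (1 : ℝ) ≤ |(c : ℝ)| := by exact_mod_cast Int.one_le_abs hc
    have h2 : ((c : ℂ) * (((n + 1 : ℝ) : ℂ) * Complex.I) + d).im = c * (n + 1) := by simp
    rw [h2, abs_mul, abs_of_nonneg (by positivity : (0 : ℝ) ≤ n + 1)]
    nlinarith [(Nat.cast_nonneg n : (0 : ℝ) ≤ n)]
  have := (tendsto_inv₀_cobounded.comp (tendsto_norm_atTop_iff_cobounded.mp hnorm)).pow k
  rw [zero_pow hk] at this
  exact this.congr fun n => by simp [zpow_neg]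

section

variable {V : Type*} [AddCommGroup V] [Module ℂ V]

/-- The summand of `eisComponent` attached to a matrix. -/
noncomputable def eisTerm (ρ : Representation ℂ SL(2, ℤ) V) (k : ℕ) (v : V)
    (w : Module.Dual ℂ V) (τ : ℍ) (g : SL(2, ℤ)) : ℂ :=
  (((g.1 1 0 : ℤ) : ℂ) * (τ : ℂ) + ((g.1 1 1 : ℤ) : ℂ)) ^ (-(k : ℤ)) * w (ρ g⁻¹ v)

theorem eisTerm_mul_left {ρ : Representation ℂ SL(2, ℤ) V} {v : V} {k : ℕ}
    (hvT : ρ ModularGroup.T v = v) (hpar : ∀ x : V, ρ (-1) x = ((-1 : ℂ)) ^ k • x)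
    (w : Module.Dual ℂ V) (τ : ℍ) {h : SL(2, ℤ)} (hh : h ∈ GammaInf) (g : SL(2, ℤ)) :
    eisTerm ρ k v w τ (h * g) = eisTerm ρ k v w τ g := by
  induction hh using Subgroup.closure_induction generalizing g with
  | mem x hx =>
    rcases hx with rfl | rfl
    · have : ρ ModularGroup.T⁻¹ v = v := by
        conv_lhs => rw [← hvT]
        simp [← Module.End.mul_apply, ← map_mul]
      simp [eisTerm, this]
    · have hsq : ((-1 : ℂ) ^ k)⁻¹ * (-1) ^ k = 1 := inv_mul_cancel₀ (by simp)
      have hneg : ∀ a b : ℂ, -(a * (τ : ℂ)) + -b = (-1) * (a * τ + b) := fun a b => by ring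
      have hinv : (-1 * g)⁻¹ = g⁻¹ * (-1) := by simp
      rw [eisTerm, hinv, map_mul, Module.End.mul_apply, hpar]
      simp only [map_smul, smul_eq_mul, eisTerm, neg_mul, one_mul,
        Matrix.SpecialLinearGroup.coe_neg, Matrix.neg_apply, Int.cast_neg]
      rw [hneg, mul_zpow, zpow_neg, zpow_natCast]
      linear_combination (((g.1 1 0 : ℤ) : ℂ) * (τ : ℂ) + ((g.1 1 1 : ℤ) : ℂ)) ^ (-(k : ℤ)) *
        w (ρ g⁻¹ v) * hsq
  | one => simp
  | mul x y _ _ hx hy => rw [mul_assoc, hx, hy]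
  | inv x _ hx => rw [← hx, mul_inv_cancel_left]

theorem eisTerm_congr {ρ : Representation ℂ SL(2, ℤ) V} {v : V} {k : ℕ}
    (hvT : ρ ModularGroup.T v = v) (hpar : ∀ x : V, ρ (-1) x = ((-1 : ℂ)) ^ k • x)
    (w : Module.Dual ℂ V) (τ : ℍ) {g h : SL(2, ℤ)}
    (hgh : QuotientGroup.rightRel GammaInf g h) :
    eisTerm ρ k v w τ g = eisTerm ρ k v w τ h := by
  rw [QuotientGroup.rightRel_apply] at hgh
  simpa using (eisTerm_mul_left hvT hpar w τ hgh g).symm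

/-- Right translation on the set of right cosets of `GammaInf`. -/
def cosetMulRight (g : SL(2, ℤ)) :
    Quotient (QuotientGroup.rightRel GammaInf) ≃ Quotient (QuotientGroup.rightRel GammaInf) :=
  Quotient.congr (Equiv.mulRight g) fun a b => by
    change QuotientGroup.rightRel GammaInf a b ↔ QuotientGroup.rightRel GammaInf (a * g) (b * g)
    simp [QuotientGroup.rightRel_apply, mul_assoc]

theorem slashfn_eisComponent {ρ : Representation ℂ SL(2, ℤ) V} {v : V} {k : ℕ}
    (hvT : ρ ModularGroup.T v = v) (hpar : ∀ x : V, ρ (-1) x = ((-1 : ℂ)) ^ k • x)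
    (γ : SL(2, ℤ)) (w : Module.Dual ℂ V) :
    slashfn k γ (eisComponent ρ k v w) = eisComponent ρ k v (w ∘ₗ ρ γ) := by
  funext τ
  change _ = ∑' q : Quotient (QuotientGroup.rightRel GammaInf),
    eisTerm ρ k v (w ∘ₗ ρ γ) τ q.out
  rw [slashfn, eisComponent, ← tsum_mul_left]
  conv_rhs => rw [← (cosetMulRight γ).tsum_eq]
  refine tsum_congr fun q => ?_
  have hq : QuotientGroup.rightRel GammaInf (cosetMulRight γ q).out (q.out * γ) := by
    apply Quotient.exact
    rw [Quotient.out_eq]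
    conv_lhs => rw [← Quotient.out_eq q]
    rfl
  rw [eisTerm_congr hvT hpar _ τ hq, eisTerm, automorphy_mul, mul_zpow, LinearMap.comp_apply,
    mul_inv_rev, ← Module.End.mul_apply, ← map_mul, mul_inv_cancel_left]
  ring

theorem finite_orbit (ρ : Representation ℂ SL(2, ℤ) V)
    (hcong : ∃ N : ℕ, 0 < N ∧ ∀ γ ∈ CongruenceSubgroup.Gamma N, ρ γ = 1) (v : V) :
    (Set.range fun g => ρ g v).Finite := by
  obtain ⟨N, hN, h⟩ := hcong
  have : NeZero N := ⟨hN.ne'⟩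
  have : Finite (SL(2, ℤ) ⧸ CongruenceSubgroup.Gamma N) := inferInstance
  refine (Set.finite_range fun q : SL(2, ℤ) ⧸ CongruenceSubgroup.Gamma N =>
    ρ q.out v).subset ?_
  rintro _ ⟨g, rfl⟩
  obtain ⟨n, hn⟩ := QuotientGroup.mk_out_eq_mul (CongruenceSubgroup.Gamma N) g
  refine ⟨(g : SL(2, ℤ) ⧸ CongruenceSubgroup.Gamma N), ?_⟩
  simp [hn, h n n.2]

/-- The constant term of `eisComponent` at the cusp `∞`. -/
theorem tendsto_eisComponent (ρ : Representation ℂ SL(2, ℤ) V)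
    (hcong : ∃ N : ℕ, 0 < N ∧ ∀ γ ∈ CongruenceSubgroup.Gamma N, ρ γ = 1)
    {v : V} {k : ℕ} (hk : 3 ≤ k) (hvT : ρ ModularGroup.T v = v)
    (hpar : ∀ x : V, ρ (-1) x = ((-1 : ℂ)) ^ k • x) (w : Module.Dual ℂ V) :
    Tendsto (fun n : ℕ => eisComponent ρ k v w
      ⟨((n + 1 : ℝ) : ℂ) * Complex.I, by simpa using n.cast_add_one_pos⟩) atTop (𝓝 (w v)) := by
  classical
  obtain ⟨C, hC⟩ := ((finite_orbit ρ hcong v).image fun x => ‖w x‖).bddAbove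
  have hC' : ∀ g : SL(2, ℤ), ‖w (ρ g v)‖ ≤ C := fun g => hC ⟨_, ⟨g, rfl⟩, rfl⟩
  let e : Quotient (QuotientGroup.rightRel GammaInf) := Quotient.mk _ 1
  have he : ∀ q : Quotient (QuotientGroup.rightRel GammaInf), q.out.1 1 0 = 0 → q = e := by
    intro q hq
    rw [← Quotient.out_eq q]
    refine Quotient.sound ?_
    change QuotientGroup.rightRel GammaInf _ _
    rw [QuotientGroup.rightRel_apply]
    simpa using inv_mem (mem_GammaInf_of_lower_left_eq_zero hq)
  have hinj : Function.Injective fun q : Quotient (QuotientGroup.rightRel GammaInf) =>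
      q.out.1 1 := by
    intro p q hpq
    rw [← Quotient.out_eq p, ← Quotient.out_eq q]
    refine Quotient.sound ?_
    change QuotientGroup.rightRel GammaInf _ _
    rw [QuotientGroup.rightRel_apply]
    exact mul_inv_mem_GammaInf_of_lower_row_eq (congrFun hpq 0) (congrFun hpq 1)
  have hsum := ((EisensteinSeries.summable_norm_eisSummand (k := k) (by exact_mod_cast hk)
    UpperHalfPlane.I).comp_injective hinj).mul_right C
  have hlim : w v = ∑' q : Quotient (QuotientGroup.rightRel GammaInf),
      if q = e then w v else 0 := by simp
  rw [hlim]
  refine tendsto_tsum_of_dominated_convergence hsum (fun q => ?_) (.of_forall fun n q => ?_)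
  · split_ifs with hq
    · have h1 : QuotientGroup.rightRel GammaInf q.out 1 := by
        apply Quotient.exact
        rw [Quotient.out_eq, hq]
      refine tendsto_const_nhds.congr fun n => ?_
      change _ = eisTerm ρ k v w _ q.out
      rw [eisTerm_congr hvT hpar w _ h1]
      simp [eisTerm]
    · have hc : q.out.1 1 0 ≠ 0 := fun h => hq (he q h)
      rw [← zero_mul (w (ρ (q.out)⁻¹ v))]
      exact (tendsto_mul_I_add_zpow hc _ (by omega)).mul_const _
  · rw [norm_mul]
    refine mul_le_mul ?_ (hC' _) (norm_nonneg _) (norm_nonneg _)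
    simp only [Function.comp_apply, EisensteinSeries.eisSummand, zpow_neg, zpow_natCast,
      norm_inv, norm_pow]
    have hpos := norm_pos_iff.mpr (automorphy_ne_zero q.out UpperHalfPlane.I)
    exact inv_anti₀ (pow_pos hpos k) (pow_le_pow_left₀ hpos.le
      (norm_mul_I_add_le _ _ (le_add_of_nonneg_left n.cast_nonneg)) k)

end

/-- Let `ρ` be an irreducible finite-dimensional complex representation of
`SL(2, ℤ)` with congruence kernel, possessing a nonzero `T`-fixed vector `v`, and let
`k ≥ 3` be such that `-I` acts on `ρ` by `(-1)^k`.  Then `ρ` embeds into the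
`SL(2, ℤ)`-representation `𝓔_k(ρ)` spanned by the component functions `w ∘ E_{k,ρ,v}`
for `w ∈ V(ρ)^∨`: the map `w ↦ w ∘ E_{k,ρ,v}` is injective and intertwines the action of
`SL(2, ℤ)` on `V(ρ)^∨` with the weight-`k` slash action on functions. -/
theorem rep_embeds_into_eisenstein_components
    {V : Type*} [AddCommGroup V] [Module ℂ V] [FiniteDimensional ℂ V]
    (ρ : Representation ℂ SL(2, ℤ) V)
    (hcong : ∃ N : ℕ, 0 < N ∧ ∀ γ ∈ CongruenceSubgroup.Gamma N, ρ γ = 1)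
    (hirr : ∀ W : Submodule ℂ V, (∀ (g : SL(2, ℤ)), ∀ x ∈ W, ρ g x ∈ W) → W = ⊥ ∨ W = ⊤)
    (v : V) (hv : v ≠ 0) (hvT : ρ ModularGroup.T v = v)
    (k : ℕ) (hk : 3 ≤ k)
    (hpar : ∀ x : V, ρ (-1) x = ((-1 : ℂ)) ^ k • x) :
    Function.Injective (fun w : Module.Dual ℂ V => eisComponent ρ k v w) ∧
    ∀ (γ : SL(2, ℤ)) (w : Module.Dual ℂ V),
      slashfn k γ (eisComponent ρ k v w) = eisComponent ρ k v (w ∘ₗ ρ γ) := by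
  refine ⟨fun w₁ w₂ h => ?_, slashfn_eisComponent hvT hpar⟩
  have hcoeff : ∀ γ, w₁ (ρ γ v) = w₂ (ρ γ v) := by
    intro γ
    have h' : eisComponent ρ k v (w₁ ∘ₗ ρ γ) = eisComponent ρ k v (w₂ ∘ₗ ρ γ) := by
      rw [← slashfn_eisComponent hvT hpar, ← slashfn_eisComponent hvT hpar]
      exact congrArg _ h
    have h₁ := tendsto_eisComponent ρ hcong hk hvT hpar (w₁ ∘ₗ ρ γ)
    rw [h'] at h₁
    exact tendsto_nhds_unique h₁ (tendsto_eisComponent ρ hcong hk hvT hpar (w₂ ∘ₗ ρ γ))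
  have hspan : Submodule.span ℂ (Set.range fun g => ρ g v) = ⊤ := by
    refine (hirr _ fun g x hx => ?_).resolve_left fun hbot => hv ?_
    · induction hx using Submodule.span_induction with
      | mem x hx =>
        obtain ⟨a, rfl⟩ := hx
        exact Submodule.subset_span ⟨g * a, by simp⟩
      | zero => simp
      | add x y _ _ hx hy => simpa using add_mem hx hy
      | smul c x _ hx => simpa using Submodule.smul_mem _ c hx
    · rw [← Submodule.mem_bot ℂ, ← hbot]
      exact Submodule.subset_span ⟨1, by simp⟩
  refine LinearMap.ext_on_range hspan hcoeff
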